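/- Every natural number n can be written as n = w^2 + x^2 + y^2 + z^2 with w, x, y, z integers such that w·(x + 2y + 3z - w) = 0; consequently, for this representation w·(x + 2y + 3z) is a perfect square (equal to w^2). -/

import Mathlib

/-- A positive definite integral ternary quadratic form of determinant one, given by its Gram
matrix, takes only values that are sums of three squares. -/
theorem sum_three_squares_of_ternary_det_one (a b c r s t : ℤ) (ha : 0 < a)
    (hG : 0 < a * b - t ^ 2)
    (hdet : a * b * c + 2 * r * s * t - a * r ^ 2 - b * s ^ 2 - c * t ^ 2 = 1) (x y z : ℤ) :
    ∃ u v w : ℤ, a * x ^ 2 + b * y ^ 2 + c * z ^ 2 + 2 * r * y * z + 2 * s * x * z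
      + 2 * t * x * y = u ^ 2 + v ^ 2 + w ^ 2 := by
  induction hA : a.toNat using Nat.strong_induction_on generalizing a b c r s t x y z with
  | _ A ihA =>
  induction hB : (a * b - t ^ 2).toNat using Nat.strong_induction_on
    generalizing a b c r s t x y z with
  | _ B ihB =>
  -- Shift `x` to make `2 |t| ≤ a`.
  wlog ht : 2 * |t| ≤ a generalizing b c r s t x y z
  · obtain ⟨k, hk⟩ : ∃ k : ℤ, 2 * |t + k * a| ≤ a := by
      refine ⟨-((2 * t + a) / (2 * a)), ?_⟩
      have h1 := Int.emod_add_mul_ediv (2 * t + a) (2 * a)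
      have h2 := Int.emod_nonneg (2 * t + a) (by positivity : 2 * a ≠ 0)
      have h3 := Int.emod_lt_of_pos (2 * t + a) (by positivity : 0 < 2 * a)
      rcases abs_cases (t + -((2 * t + a) / (2 * a)) * a) with h | h <;> nlinarith
    have e : a * (b + 2 * k * t + k ^ 2 * a) - (t + k * a) ^ 2 = a * b - t ^ 2 := by ring
    obtain ⟨u, v, w, h⟩ := this (b + 2 * k * t + k ^ 2 * a) c (r + k * s) s (t + k * a)
      (by rw [e]; exact hG) (by linear_combination hdet) (x - k * y) y z (by rw [e]; exact hB) hk
    exact ⟨u, v, w, by rw [← h]; ring⟩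
  -- Shift `y` to reduce the off-diagonal entry of the binary form on `(y, z)`.
  wlog hg : 2 * |a * r - s * t| ≤ a * b - t ^ 2 generalizing c r s x y z
  · obtain ⟨k, hk⟩ : ∃ k : ℤ, 2 * |a * r - s * t + k * (a * b - t ^ 2)| ≤ a * b - t ^ 2 := by
      generalize a * r - s * t = g at *
      generalize a * b - t ^ 2 = G at *
      refine ⟨-((2 * g + G) / (2 * G)), ?_⟩
      have h1 := Int.emod_add_mul_ediv (2 * g + G) (2 * G)
      have h2 := Int.emod_nonneg (2 * g + G) (by positivity : 2 * G ≠ 0)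
      have h3 := Int.emod_lt_of_pos (2 * g + G) (by positivity : 0 < 2 * G)
      rcases abs_cases (g + -((2 * g + G) / (2 * G)) * G) with h | h <;> nlinarith
    have e : a * (r + k * b) - (s + k * t) * t = a * r - s * t + k * (a * b - t ^ 2) := by ring
    obtain ⟨u, v, w, h⟩ := this (c + 2 * k * r + k ^ 2 * b) (r + k * b) (s + k * t)
      (by linear_combination hdet) x (y - k * z) z (by rw [e]; exact hk)
    exact ⟨u, v, w, by rw [← h]; ring⟩
  have hb : 0 < b := by nlinarith [sq_nonneg t]
  have hGG : (a * b - t ^ 2) * (a * c - s ^ 2) - (a * r - s * t) ^ 2 = a := by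
    linear_combination a * hdet
  have hG' : 0 < a * c - s ^ 2 := by nlinarith [sq_nonneg (a * r - s * t)]
  by_cases h1 : b < a
  · obtain ⟨u, v, w, h⟩ := ihA b.toNat (by omega) b a c s r t hb (by linarith)
      (by linear_combination hdet) y x z rfl
    exact ⟨u, v, w, by rw [← h]; ring⟩
  by_cases h2 : a * c - s ^ 2 < a * b - t ^ 2
  · obtain ⟨u, v, w, h⟩ := ihB (a * c - s ^ 2).toNat (by omega) a c b r t s ha hG'
      (by linear_combination hdet) x z y hA rfl
    exact ⟨u, v, w, by rw [← h]; ring⟩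
  push Not at h1 h2
  have ht2 : 4 * t ^ 2 ≤ a ^ 2 := by
    have := abs_nonneg t
    nlinarith [sq_abs t]
  have hg2 : 4 * (a * r - s * t) ^ 2 ≤ (a * b - t ^ 2) ^ 2 := by
    have := abs_nonneg (a * r - s * t)
    nlinarith [sq_abs (a * r - s * t)]
  have h3 : 3 * a ^ 2 ≤ 4 * (a * b - t ^ 2) := by nlinarith
  have h4 : 3 * (a * b - t ^ 2) ^ 2 ≤ 4 * a := by nlinarith
  have ha1 : a = 1 := by
    by_contra hne
    have : 2 ≤ a := by omega
    have h5 : 3 * a ≤ 2 * (a * b - t ^ 2) := by nlinarith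
    nlinarith
  subst ha1
  have ht0 : t = 0 := by
    have : |t| = 0 := by have := abs_nonneg t; omega
    simpa using this
  subst ht0
  have hb1 : b = 1 := by nlinarith
  subst hb1
  have hr0 : r = 0 := by
    have : |1 * r - s * 0| = 0 := by have := abs_nonneg (1 * r - s * 0); omega
    simpa using this
  subst hr0
  exact ⟨x + s * z, y, z, by linear_combination z ^ 2 * hdet⟩

theorem sum_three_squares_of_dvd_sq_add {n d p a : ℤ} (hd : 0 < d) (hp : 0 < p)
    (hpd : p + 1 = d * n) (h : p ∣ a ^ 2 + d) : ∃ u v w : ℤ, n = u ^ 2 + v ^ 2 + w ^ 2 := by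
  obtain ⟨k, hk⟩ := h
  have hk0 : 0 < k := by
    by_contra hneg
    nlinarith [sq_nonneg a]
  obtain ⟨u, v, w, h⟩ := sum_three_squares_of_ternary_det_one k p n 0 1 a hk0 (by linarith)
    (by linear_combination (-n) * hk - hpd) 0 0 1
  exact ⟨u, v, w, by rw [← h]; ring⟩

theorem exists_dvd_sq_add_of_jacobiSym_eq_one {p d : ℕ} (hp : p.Prime)
    (h : jacobiSym (-d) p = 1) : ∃ a : ℤ, (p : ℤ) ∣ a ^ 2 + d := by
  have : Fact p.Prime := ⟨hp⟩
  obtain ⟨x, hx⟩ := ZMod.isSquare_of_jacobiSym_eq_one h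
  refine ⟨x.val, (ZMod.intCast_zmod_eq_zero_iff_dvd _ _).1 ?_⟩
  push_cast at hx ⊢
  rw [ZMod.natCast_zmod_val]
  linear_combination -hx

theorem jacobiSym_neg_left_eq_swap {d p : ℕ} (hd : Odd d) (hp : Odd p)
    (h : p % 4 = 1 ∨ d % 4 = 3) : jacobiSym (-d) p = jacobiSym p d := by
  rw [neg_eq_neg_one_mul, jacobiSym.mul_left, jacobiSym.at_neg_one hp]
  by_cases hp1 : p % 4 = 1
  · rw [ZMod.χ₄_nat_one_mod_four hp1, one_mul,
      jacobiSym.quadratic_reciprocity_one_mod_four' hd hp1]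
  · have hp3 : p % 4 = 3 := by
      have := Nat.odd_iff.1 hp
      omega
    rw [ZMod.χ₄_nat_three_mod_four hp3,
      jacobiSym.quadratic_reciprocity_three_mod_four (h.resolve_left hp1) hp3]
    ring

/-- If `k * q + 1 = c * n` with `q` odd, then some prime `p` in the residue class of `q` modulo
`4 * n` satisfies `k * p + 1 = (4 * k * j + c) * n`. -/
theorem exists_prime_mul_add_one_eq {k q c n : ℕ} (hn : n ≠ 0) (hq : Odd q)
    (h : k * q + 1 = c * n) :
    ∃ p j : ℕ, p.Prime ∧ p = 4 * n * j + q ∧ k * p + 1 = (4 * k * j + c) * n := by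
  have hqn : q.Coprime n := by
    refine Nat.isCoprime_iff_coprime.1 ⟨-k, c, ?_⟩
    have : (k * q + 1 : ℤ) = c * n := by exact_mod_cast h
    linear_combination -this
  have hq4 : q.Coprime 4 := Nat.Coprime.pow_right 2 (Nat.coprime_two_right.2 hq)
  obtain ⟨p, hgt, hp, hmod⟩ := Nat.forall_exists_prime_gt_and_modEq q
    (by omega : 4 * n ≠ 0) (hq4.mul_right hqn)
  obtain ⟨j, hj⟩ := (Nat.modEq_iff_dvd' hgt.le).1 hmod.symm
  have hpj : p = 4 * n * j + q := by omega
  refine ⟨p, j, hp, hpj, ?_⟩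
  rw [hpj]
  linear_combination h

theorem sum_three_squares_of_mod_four_eq_two {n : ℕ} (hn : n % 4 = 2) :
    ∃ u v w : ℤ, (n : ℤ) = u ^ 2 + v ^ 2 + w ^ 2 := by
  obtain ⟨p, j, hp, hpj, hd⟩ := exists_prime_mul_add_one_eq (k := 1) (q := n - 1) (c := 1) (n := n)
    (by omega) (Nat.odd_iff.2 (by omega)) (by omega)
  have hp4 : p % 4 = 1 := by
    rw [hpj, mul_assoc]
    omega
  have hd1 : (4 * 1 * j + 1) % 4 = 1 := by omega
  generalize 4 * 1 * j + 1 = d at *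
  have hdZ : (p : ℤ) + 1 = d * n := by
    have : ((1 * p + 1 : ℕ) : ℤ) = (d * n : ℕ) := by rw [hd]
    push_cast at this
    linarith
  have hdo : Odd d := Nat.odd_iff.2 (by omega)
  have hJ : jacobiSym (-d) p = 1 := by
    rw [jacobiSym_neg_left_eq_swap hdo (Nat.odd_iff.2 (by omega)) (Or.inl hp4),
      jacobiSym.mod_left' (Int.modEq_iff_dvd.2 ⟨-n, by linarith⟩ : (p : ℤ) ≡ -1 [ZMOD d]),
      jacobiSym.at_neg_one hdo, ZMod.χ₄_nat_one_mod_four hd1]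
  obtain ⟨a, ha⟩ := exists_dvd_sq_add_of_jacobiSym_eq_one hp hJ
  exact sum_three_squares_of_dvd_sq_add (by omega) (by exact_mod_cast hp.pos) hdZ ha

theorem sum_three_squares_of_half_odd {n q c : ℕ} (hq : Odd q) (h : 2 * q + 1 = c * n)
    (hc : c % 8 = 1 ∨ c % 8 = 3) (hqc : q % 4 = 1 ∨ c % 4 = 3) :
    ∃ u v w : ℤ, (n : ℤ) = u ^ 2 + v ^ 2 + w ^ 2 := by
  have hn : n ≠ 0 := by
    rintro rfl
    omega
  obtain ⟨p, j, hp, hpj, hd⟩ := exists_prime_mul_add_one_eq hn hq h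
  have hp4 : p % 4 = q % 4 := by
    rw [hpj, mul_assoc]
    omega
  have hd8 : (4 * 2 * j + c) % 8 = c % 8 := by omega
  generalize 4 * 2 * j + c = d at *
  have hdZ : 2 * (p : ℤ) + 1 = d * n := by exact_mod_cast hd
  have hdo : Odd d := Nat.odd_iff.2 (by omega)
  have hpo : Odd p := by
    rw [Nat.odd_iff] at hq ⊢
    omega
  have hJ : jacobiSym (-d) p = 1 := by
    rw [jacobiSym_neg_left_eq_swap hdo hpo (by omega)]
    have h1 : jacobiSym (-2 * p) d = 1 := by
      rw [jacobiSym.mod_left' (a₂ := 1), jacobiSym.one_left]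
      exact (Int.modEq_iff_dvd.2 ⟨n, by linarith⟩ : -2 * (p : ℤ) ≡ 1 [ZMOD d])
    have h2 : jacobiSym (-2) d = 1 := by
      rw [jacobiSym.at_neg_two hdo, ZMod.χ₈'_nat_eq_if_mod_eight]
      rw [if_neg (by omega), if_pos (by omega)]
    rwa [jacobiSym.mul_left, h2, one_mul] at h1
  obtain ⟨a, ha⟩ := exists_dvd_sq_add_of_jacobiSym_eq_one hp hJ
  -- Replace `a` by an odd representative, so that `2 * p` divides `a ^ 2 + d`.
  obtain ⟨b, hb, hb2⟩ : ∃ b : ℤ, (p : ℤ) ∣ b ^ 2 + d ∧ Odd b := by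
    rcases Int.even_or_odd a with hev | hod
    · refine ⟨a + p, ?_, hev.add_odd (by exact_mod_cast hpo)⟩
      have : (a + p) ^ 2 + (d : ℤ) = (a ^ 2 + d) + p * (2 * a + p) := by ring
      rw [this]
      exact ha.add (dvd_mul_right _ _)
    · exact ⟨a, ha, hod⟩
  have h2 : (2 : ℤ) ∣ b ^ 2 + d := (hb2.pow.add_odd (by exact_mod_cast hdo)).two_dvd
  have hcop : IsCoprime (2 : ℤ) p :=
    Nat.isCoprime_iff_coprime.2 (Nat.coprime_two_left.2 hpo)
  have hp0 : (0 : ℤ) < p := by exact_mod_cast hp.pos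
  exact sum_three_squares_of_dvd_sq_add (d := d) (by omega) (by positivity) hdZ
    (hcop.mul_dvd h2 hb)

/-- Legendre's three-square theorem for integers not divisible by four. -/
theorem sum_three_squares_of_mod_eight {n : ℕ} (h4 : n % 4 ≠ 0) (h8 : n % 8 ≠ 7) :
    ∃ u v w : ℤ, (n : ℤ) = u ^ 2 + v ^ 2 + w ^ 2 := by
  have h : n % 4 = 2 ∨ n % 8 = 3 ∨ n % 4 = 1 := by omega
  rcases h with h | h | h
  · exact sum_three_squares_of_mod_four_eq_two h
  · exact sum_three_squares_of_half_odd (q := (n - 1) / 2) (c := 1) (Nat.odd_iff.2 (by omega))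
      (by omega) (by omega) (by omega)
  · exact sum_three_squares_of_half_odd (q := (3 * n - 1) / 2) (c := 3) (Nat.odd_iff.2 (by omega))
      (by omega) (by omega) (by omega)

theorem exists_neg_or_self_modEq_three {u : ℤ} (hu : u % 3 ≠ 0) :
    ∃ v : ℤ, v ^ 2 = u ^ 2 ∧ v % 3 = 1 := by
  have : u % 3 = 1 ∨ (-u) % 3 = 1 := by omega
  rcases this with h | h
  exacts [⟨u, rfl, h⟩, ⟨-u, by ring, h⟩]

theorem sq_emod_three (u : ℤ) : (u % 3 = 0 ∧ u ^ 2 % 3 = 0) ∨ (u % 3 ≠ 0 ∧ u ^ 2 % 3 = 1) := by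
  have : u % 3 = 0 ∨ u % 3 = 1 ∨ u % 3 = 2 := by omega
  rcases this with h | h | h <;> simp [h, pow_two, Int.mul_emod]

theorem sq_emod_five (u : ℤ) : (u % 5 = 0 ∧ u ^ 2 % 5 = 0) ∨
    ((u % 5 = 1 ∨ u % 5 = 4) ∧ u ^ 2 % 5 = 1) ∨ ((u % 5 = 2 ∨ u % 5 = 3) ∧ u ^ 2 % 5 = 4) := by
  have : u % 5 = 0 ∨ u % 5 = 1 ∨ u % 5 = 2 ∨ u % 5 = 3 ∨ u % 5 = 4 := by omega
  rcases this with h | h | h | h | h <;> simp [h, pow_two, Int.mul_emod]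

/-- The signs in a sum of three squares divisible by three can be chosen such that the terms are
all congruent modulo three. -/
theorem exists_sum_three_squares_modEq_three {m u v w : ℤ} (hm : m % 3 = 0)
    (h : m = u ^ 2 + v ^ 2 + w ^ 2) :
    ∃ u v w : ℤ, m = u ^ 2 + v ^ 2 + w ^ 2 ∧ u % 3 = v % 3 ∧ v % 3 = w % 3 := by
  have hu := sq_emod_three u
  have hv := sq_emod_three v
  have hw := sq_emod_three w
  by_cases hu0 : u % 3 = 0
  · exact ⟨u, v, w, h, by omega, by omega⟩
  · obtain ⟨u', hu', hu1⟩ := exists_neg_or_self_modEq_three hu0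
    obtain ⟨v', hv', hv1⟩ := exists_neg_or_self_modEq_three (u := v) (by omega)
    obtain ⟨w', hw', hw1⟩ := exists_neg_or_self_modEq_three (u := w) (by omega)
    exact ⟨u', v', w', by omega, by omega, by omega⟩

/-- The terms of a sum of three squares divisible by five can be permuted such that they are
proportional to `(0, 1, 2)` modulo five. -/
theorem exists_sum_three_squares_modEq_five {m u v w : ℤ} (hm : m % 5 = 0)
    (h : m = u ^ 2 + v ^ 2 + w ^ 2) (huv : u % 3 = v % 3) (hvw : v % 3 = w % 3) :
    ∃ u v w : ℤ, m = u ^ 2 + v ^ 2 + w ^ 2 ∧ u % 3 = v % 3 ∧ v % 3 = w % 3 ∧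
      u % 5 = 0 ∧ w % 5 = (2 * v) % 5 := by
  wlog hu0 : u % 5 = 0 generalizing u v w
  · have hu := sq_emod_five u
    have hv := sq_emod_five v
    have hw := sq_emod_five w
    by_cases hv0 : v % 5 = 0
    · exact this (u := v) (v := u) (w := w) (by omega) (by omega) (by omega) hv0
    · exact this (u := w) (v := v) (w := u) (by omega) (by omega) (by omega) (by omega)
  have hu2 : u ^ 2 % 5 = 0 := by simp [pow_two, Int.mul_emod, hu0]
  have hvw2 : (v ^ 2 + w ^ 2) % 5 = 0 := by omega
  by_cases hw0 : w % 5 = (2 * v) % 5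
  · exact ⟨u, v, w, h, huv, hvw, hu0, hw0⟩
  · have hdvd : (5 : ℤ) ∣ (w - 2 * v) * (v - 2 * w) := by
      have e : (w - 2 * v) * (v - 2 * w) = 5 * (v * w) - 2 * (v ^ 2 + w ^ 2) := by ring
      rw [e]
      omega
    have hor := (Int.prime_iff_natAbs_prime.2 Nat.prime_five : Prime (5 : ℤ)).dvd_or_dvd hdvd
    exact ⟨u, w, v, by linarith, by omega, by omega, hu0, by omega⟩

/-- If `15 * n` is a sum of three squares, then `n` is a sum of four squares whose roots lie on the
hyperplane `w = x + 2 * y + 3 * z`. -/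
theorem exists_sum_four_squares_of_fifteen_mul {n u v w : ℤ} (h : 15 * n = u ^ 2 + v ^ 2 + w ^ 2) :
    ∃ w x y z : ℤ, n = w ^ 2 + x ^ 2 + y ^ 2 + z ^ 2 ∧ w = x + 2 * y + 3 * z := by
  obtain ⟨u, v, w, h, huv, hvw⟩ := exists_sum_three_squares_modEq_three (by omega) h
  obtain ⟨u, v, w, h, huv, hvw, hu, hw⟩ :=
    exists_sum_three_squares_modEq_five (by omega) h huv hvw
  obtain ⟨α, hα⟩ : ∃ α, 2 * u + 2 * v - w = 15 * α := ⟨(2 * u + 2 * v - w) / 15, by omega⟩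
  obtain ⟨β, hβ⟩ : ∃ β, u - 2 * v + w = 15 * β := ⟨(u - 2 * v + w) / 15, by omega⟩
  obtain ⟨γ, hγ⟩ : ∃ γ, v + 2 * w = 15 * γ := ⟨(v + 2 * w) / 15, by omega⟩
  have eu : u = 5 * α + 5 * β := by omega
  have ev : v = 2 * α - 4 * β + 3 * γ := by omega
  have ew : w = -α + 2 * β + 6 * γ := by omega
  refine ⟨α + γ, α + β - γ, β + γ, -β, ?_, by ring⟩
  rw [eu, ev, ew] at h
  linarith

theorem stmt_8 (n : ℕ) :
    ∃ w x y z : ℤ, (n : ℤ) = w ^ 2 + x ^ 2 + y ^ 2 + z ^ 2 ∧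
      w * (x + 2 * y + 3 * z - w) = 0 ∧
      w * (x + 2 * y + 3 * z) = w ^ 2 := by
  induction n using Nat.strong_induction_on with
  | _ n ih =>
  by_cases h4 : n % 4 = 0
  · rcases Nat.eq_zero_or_pos n with rfl | hn
    · exact ⟨0, 0, 0, 0, by simp⟩
    · obtain ⟨w, x, y, z, h, h0, h1⟩ := ih (n / 4) (by omega)
      exact ⟨2 * w, 2 * x, 2 * y, 2 * z, by ring_nf at h ⊢; omega,
        by linear_combination 4 * h0, by linear_combination 4 * h1⟩
  by_cases h8 : n % 8 = 7
  · obtain ⟨u, v, w, h⟩ := sum_three_squares_of_mod_eight (n := 15 * n) (by omega) (by omega)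
    obtain ⟨w, x, y, z, hn, hw⟩ := exists_sum_four_squares_of_fifteen_mul (n := n)
      (by exact_mod_cast h)
    exact ⟨w, x, y, z, hn, by rw [← hw]; ring, by rw [← hw]; ring⟩
  · obtain ⟨u, v, w, h⟩ := sum_three_squares_of_mod_eight h4 h8
    exact ⟨0, u, v, w, by linarith, by ring, by ring⟩
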